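/- arXiv:math/0407328 — 2 statements merged into one kernel-verified Lean document; each statement's English description precedes it below -/
import Mathlib

section
/- Let H be a finite-index subgroup of ℤ × ℤ. Then H contains a primitive element of ℤ × ℤ if and only if the quotient group (ℤ × ℤ)/H is cyclic. -/
/-- Every homogeneous linear equation in two integer unknowns has a primitive solution. -/
theorem Int.exists_gcd_eq_one_and_mul_add_mul_eq_zero (p q : ℤ) :
    ∃ x y : ℤ, Int.gcd x y = 1 ∧ x * p + y * q = 0 := by
  rcases Nat.eq_zero_or_pos (Int.gcd p q) with h | h
  · obtain ⟨rfl, rfl⟩ := Int.gcd_eq_zero_iff.mp h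
    exact ⟨1, 0, by simp, by simp⟩
  · obtain ⟨p', q', hcop, hp, hq⟩ := Int.exists_gcd_one h
    refine ⟨q', -p', by rwa [Int.gcd_neg, Int.gcd_comm], ?_⟩
    linear_combination q' * hp - p' * hq

theorem isAddCyclic_quotient_of_gcd_eq_one {H : AddSubgroup (ℤ × ℤ)} {x : ℤ × ℤ}
    (hx : x ∈ H) (hgcd : Int.gcd x.1 x.2 = 1) : IsAddCyclic ((ℤ × ℤ) ⧸ H) := by
  obtain ⟨a, b⟩ := x
  obtain ⟨u, v, huv⟩ := Int.isCoprime_iff_gcd_eq_one.mpr hgcd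
  dsimp only at huv
  refine ⟨((-v, u) : ℤ × ℤ), fun z => ?_⟩
  obtain ⟨⟨c, d⟩, rfl⟩ := QuotientAddGroup.mk_surjective z
  refine AddSubgroup.mem_zmultiples_iff.mpr ⟨a * d - b * c, ?_⟩
  rw [← QuotientAddGroup.mk_zsmul, QuotientAddGroup.eq]
  convert H.zsmul_mem hx (u * c + v * d) using 1
  ext
  · simp only [Prod.fst_add, Prod.fst_neg, Prod.smul_fst, smul_eq_mul]
    linear_combination (-c) * huv
  · simp only [Prod.snd_add, Prod.snd_neg, Prod.smul_snd, smul_eq_mul]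
    linear_combination (-d) * huv

theorem exists_mem_gcd_eq_one_of_isAddCyclic_quotient {H : AddSubgroup (ℤ × ℤ)}
    (hcyc : IsAddCyclic ((ℤ × ℤ) ⧸ H)) : ∃ x : ℤ × ℤ, x ∈ H ∧ Int.gcd x.1 x.2 = 1 := by
  obtain ⟨g, hg⟩ := hcyc
  obtain ⟨p, hp⟩ := AddSubgroup.mem_zmultiples_iff.mp (hg ((1, 0) : ℤ × ℤ))
  obtain ⟨q, hq⟩ := AddSubgroup.mem_zmultiples_iff.mp (hg ((0, 1) : ℤ × ℤ))
  obtain ⟨x, y, hxy, h0⟩ := Int.exists_gcd_eq_one_and_mul_add_mul_eq_zero p q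
  refine ⟨(x, y), ?_, hxy⟩
  have hdecomp : ((x, y) : ℤ × ℤ) = x • (1, 0) + y • (0, 1) := by simp
  rw [← QuotientAddGroup.eq_zero_iff, hdecomp, QuotientAddGroup.mk_add,
    QuotientAddGroup.mk_zsmul, QuotientAddGroup.mk_zsmul, ← hp, ← hq, ← mul_zsmul', ← mul_zsmul',
    ← add_zsmul, mul_comm p, mul_comm q, h0, zero_zsmul]

/-- Let `H` be a finite-index subgroup of `ℤ × ℤ`. Then `H` contains a primitive element
of `ℤ × ℤ` (i.e. an element `(a, b)` with `gcd a b = 1`) if and only if the quotient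
group `(ℤ × ℤ)/H` is cyclic. -/
theorem finiteIndex_subgroup_contains_primitive_iff_quotient_cyclic
    (H : AddSubgroup (ℤ × ℤ)) (hH : H.FiniteIndex) :
    (∃ x : ℤ × ℤ, x ∈ H ∧ Int.gcd x.1 x.2 = 1) ↔ IsAddCyclic ((ℤ × ℤ) ⧸ H) := by
  exact ⟨fun ⟨_, hx, hgcd⟩ => isAddCyclic_quotient_of_gcd_eq_one hx hgcd,
    exists_mem_gcd_eq_one_of_isAddCyclic_quotient⟩
end

section
/- Let H be a finite-index subgroup of ℤ × ℤ such that the quotient group (ℤ × ℤ)/H is cyclic. Then there exists an infinite set S of primitive elements of ℤ × ℤ contained in H such that no two distinct elements of S are parallel (i.e., for distinct γ, γ' ∈ S, the determinant γ₁γ'₂ − γ₂γ'₁ is nonzero). -/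
/-- The kernel of any linear form `(x, y) ↦ a * x + b * y` contains a primitive vector. -/
theorem exists_isCoprime_mul_add_mul_eq_zero (a b : ℤ) :
    ∃ x y : ℤ, IsCoprime x y ∧ a * x + b * y = 0 := by
  by_cases h : Int.gcd a b = 0
  · obtain ⟨rfl, rfl⟩ := Int.gcd_eq_zero_iff.mp h
    exact ⟨1, 0, isCoprime_one_left, by simp⟩
  · obtain ⟨a', b', hab, ha, hb⟩ := Int.exists_gcd_one (Nat.pos_of_ne_zero h)
    refine ⟨b', -a', (Int.isCoprime_iff_gcd_eq_one.mpr hab).symm.neg_right, ?_⟩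
    generalize (Int.gcd a b : ℤ) = d at ha hb
    rw [ha, hb]
    ring

/-- A subgroup of `ℤ × ℤ` with cyclic quotient contains a primitive vector. -/
theorem AddSubgroup.exists_isCoprime_mem_of_isAddCyclic_quotient (H : AddSubgroup (ℤ × ℤ))
    (hcyc : IsAddCyclic ((ℤ × ℤ) ⧸ H)) : ∃ x y : ℤ, IsCoprime x y ∧ (x, y) ∈ H := by
  obtain ⟨g, hg⟩ := hcyc.exists_zsmul_surjective
  obtain ⟨a, ha⟩ := hg (QuotientAddGroup.mk' H (1, 0))
  obtain ⟨b, hb⟩ := hg (QuotientAddGroup.mk' H (0, 1))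
  obtain ⟨x, y, hxy, h⟩ := exists_isCoprime_mul_add_mul_eq_zero a b
  refine ⟨x, y, hxy, ?_⟩
  have hdecomp : ((x, y) : ℤ × ℤ) = x • (1, 0) + y • (0, 1) := by simp
  rw [← QuotientAddGroup.ker_mk' H, AddMonoidHom.mem_ker, hdecomp, map_add, map_zsmul, map_zsmul,
    ← ha, ← hb, ← mul_zsmul', ← mul_zsmul', ← add_zsmul, h, zero_zsmul]

/-- Let `H` be a finite-index subgroup of `ℤ × ℤ` with cyclic quotient `(ℤ × ℤ)/H`.
Then there is an infinite set `S` of primitive elements of `ℤ × ℤ` contained in `H`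
such that no two distinct elements of `S` are parallel. -/
theorem infinitely_many_nonparallel_primitives_in_cyclic_quotient_subgroup
    (H : AddSubgroup (ℤ × ℤ)) (hH : H.FiniteIndex)
    (hcyc : IsAddCyclic ((ℤ × ℤ) ⧸ H)) :
    ∃ S : Set (ℤ × ℤ), S.Infinite ∧ S ⊆ (H : Set (ℤ × ℤ)) ∧
      (∀ γ ∈ S, Int.gcd γ.1 γ.2 = 1) ∧
      (∀ γ ∈ S, ∀ γ' ∈ S, γ ≠ γ' → γ.1 * γ'.2 - γ.2 * γ'.1 ≠ 0) := by
  obtain ⟨x, y, ⟨s, t, hst⟩, hv⟩ := H.exists_isCoprime_mem_of_isAddCyclic_quotient hcyc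
  have hn : (H.index : ℤ) ≠ 0 := Nat.cast_ne_zero.mpr hH.index_ne_zero
  have hw : (H.index : ℤ) • ((-t, s) : ℤ × ℤ) ∈ H := by
    rw [natCast_zsmul]
    exact H.nsmul_index_mem _
  generalize (H.index : ℤ) = n at hn hw
  let f : ℤ → ℤ × ℤ := fun k ↦ (x, y) + k • n • (-t, s)
  have hf₁ (k : ℤ) : (f k).1 = x - k * n * t := by simp [f]; ring
  have hf₂ (k : ℤ) : (f k).2 = y + k * n * s := by simp [f]; ring
  have hdet (j k : ℤ) : (f j).1 * (f k).2 - (f j).2 * (f k).1 = (k - j) * n := by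
    simp only [hf₁, hf₂]
    linear_combination (k - j) * n * hst
  have hinj : Function.Injective f := by
    intro j k hjk
    have h := hdet j k
    rw [hjk, mul_comm, sub_self, zero_eq_mul] at h
    exact (sub_eq_zero.mp (h.resolve_right hn)).symm
  refine ⟨Set.range f, Set.infinite_range_of_injective hinj, ?_, ?_, ?_⟩
  · rintro _ ⟨k, rfl⟩
    exact H.add_mem hv (H.zsmul_mem hw k)
  · rintro _ ⟨k, rfl⟩
    refine Int.isCoprime_iff_gcd_eq_one.mp ⟨s, t, ?_⟩
    rw [hf₁, hf₂]
    linear_combination hst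
  · rintro _ ⟨j, rfl⟩ _ ⟨k, rfl⟩ hjk
    rw [hdet]
    exact mul_ne_zero (sub_ne_zero.mpr fun h ↦ hjk (congrArg f h.symm)) hn
end
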